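/- arXiv:1612.07048 — 2 statements merged into one kernel-verified Lean document; each statement's English description precedes it below -/
import Mathlib

section
/- Let L ⊆ ℝ[x, y] be the 14-dimensional ℝ-linear subspace spanned by the monomials x, x², x³, x⁴, x⁵, x⁶, y, y², y³, y⁴, xy, x²y, xy², x²y², and let φ_L : ℝ² → ℝ^14 be the map evaluating these 14 monomials, φ_L(ξ) = (ξ_1, ξ_1², …, ξ_1⁶, ξ_2, ξ_2², ξ_2³, ξ_2⁴, ξ_1ξ_2, ξ_1²ξ_2, ξ_1ξ_2², ξ_1²ξ_2²). Then for every semialgebraic set S ⊆ ℝ² with non-empty interior, the closed convex hull of φ_L(S) in ℝ^14 is not a spectrahedral shadow. -/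
/-- A set `K ⊆ ℝ^k` is a spectrahedral shadow if it is the feasible-region projection of a
symmetric linear matrix inequality. -/
def IsSpectrahedralShadow {k : ℕ} (K : Set (Fin k → ℝ)) : Prop :=
  ∃ (d m : ℕ), 0 < d ∧ ∃ (A : Matrix (Fin d) (Fin d) ℝ)
    (B : Fin k → Matrix (Fin d) (Fin d) ℝ) (C : Fin m → Matrix (Fin d) (Fin d) ℝ),
    A.IsSymm ∧ (∀ i, (B i).IsSymm) ∧ (∀ j, (C j).IsSymm) ∧
    K = {ξ | ∃ η : Fin m → ℝ, (A + ∑ i, ξ i • B i + ∑ j, η j • C j).PosSemidef}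

/-- A set `S ⊆ ℝ^n` is semialgebraic: a finite union of sets given by one polynomial
equation and finitely many strict polynomial inequalities. -/
def IsSemialgebraic {n : ℕ} (S : Set (Fin n → ℝ)) : Prop :=
  ∃ (r : ℕ) (p : Fin r → MvPolynomial (Fin n) ℝ) (s : Fin r → ℕ)
    (q : (i : Fin r) → Fin (s i) → MvPolynomial (Fin n) ℝ),
    S = ⋃ i, {ξ | MvPolynomial.eval ξ (p i) = 0 ∧ ∀ j, 0 < MvPolynomial.eval ξ (q i j)}

/-- A field extension in characteristic zero is formally smooth. -/
lemma formallySmooth_of_charZero (K L : Type*) [Field K] [Field L] [CharZero K] [Algebra K L] :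
    Algebra.FormallySmooth K L := by
  obtain ⟨s, hs⟩ := exists_isTranscendenceBasis K L
  have := hs.isAlgebraic_field
  exact .of_algebraicIndependent_of_isSeparable hs.1

open Polynomial in
lemma exists_derivation_apply_eq_one {K L : Type*} [Field K] [Field L] [CharZero K] [Algebra K L]
    {x : L} (hx : Transcendental K x) : ∃ D : Derivation K L L, D x = 1 := by
  let : Algebra K[X] L := (aeval x).toAlgebra
  let : Algebra K[X] (TrivSqZeroExt L L) :=
    (aeval (TrivSqZeroExt.inl x + TrivSqZeroExt.inr 1 : TrivSqZeroExt L L)).toAlgebra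
  have hinj : Function.Injective (algebraMap K[X] L) := transcendental_iff_injective.1 hx
  have : FaithfulSMul K[X] L := (faithfulSMul_iff_algebraMap_injective _ _).2 hinj
  let : Algebra (FractionRing K[X]) L := FractionRing.liftAlgebra K[X] L
  have : IsScalarTower K[X] (FractionRing K[X]) L := inferInstance
  have : CharZero (FractionRing K[X]) :=
    charZero_of_injective_algebraMap (IsFractionRing.injective K[X] (FractionRing K[X]))
  have := formallySmooth_of_charZero (FractionRing K[X]) L
  have : Algebra.FormallySmooth K[X] (FractionRing K[X]) :=
    .of_isLocalization (nonZeroDivisors _)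
  have : Algebra.FormallySmooth K[X] L := .comp _ (FractionRing K[X]) _
  have hX : ∀ p : K[X], algebraMap K[X] L p = aeval x p := fun _ => rfl
  have hE : ∀ p : K[X], algebraMap K[X] (TrivSqZeroExt L L) p =
    aeval (TrivSqZeroExt.inl x + TrivSqZeroExt.inr 1 : TrivSqZeroExt L L) p := fun _ => rfl
  let g : TrivSqZeroExt L L →ₐ[K[X]] L :=
    { (TrivSqZeroExt.fstHom K L L).toRingHom with
      commutes' := fun p => by
        change TrivSqZeroExt.fstHom K L L (algebraMap K[X] _ p) = _
        rw [hE, hX, ← aeval_algHom_apply]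
        simp }
  have hsurj : Function.Surjective g := fun z => ⟨TrivSqZeroExt.inl z, rfl⟩
  have hnil : IsNilpotent (RingHom.ker g.toRingHom) := by
    have key : RingHom.ker g.toRingHom * RingHom.ker g.toRingHom ≤ ⊥ := by
      refine Ideal.mul_le.2 fun r hr s hs => ?_
      have hr : r.fst = 0 := hr
      have hs : s.fst = 0 := hs
      rw [Ideal.mem_bot]
      ext <;> simp [hr, hs]
    exact ⟨2, by rw [Submodule.pow_succ, Submodule.pow_one]; exact le_bot_iff.1 key⟩
  let h := Algebra.FormallySmooth.liftOfSurjective (AlgHom.id K[X] L) g hsurj hnil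
  have hfst : ∀ z, (h z).fst = z := fun z =>
    Algebra.FormallySmooth.liftOfSurjective_apply (AlgHom.id K[X] L) g hsurj hnil z
  have hC : ∀ k : K, h (algebraMap K L k) = TrivSqZeroExt.inl (algebraMap K L k) := by
    intro k
    have := h.commutes (C k)
    rw [hX, hE, aeval_C, aeval_C] at this
    exact this
  have hx' : h x = TrivSqZeroExt.inl x + TrivSqZeroExt.inr 1 := by
    have := h.commutes X
    rw [hX, hE] at this
    simpa using this
  refine ⟨Derivation.mk'
    { toFun := fun z => (h z).snd
      map_add' := fun a b => by simp
      map_smul' := fun k a => by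
        rw [Algebra.smul_def, map_mul, hC]
        simp [Algebra.smul_def] } ?_, ?_⟩
  · intro a b
    simp [hfst, mul_comm]
  · simp [hx']

/-- Taylor expansion along a derivation, as a ring homomorphism. -/
lemma Derivation.exists_taylor {R L : Type*} [CommRing R] [Field L] [CharZero L] [Algebra R L]
    (D : Derivation R L L) : ∃ τ : L →+* PowerSeries L,
      (∀ z, D z = 0 → τ z = PowerSeries.C z) ∧
      (∀ z, D z = 1 → τ z = PowerSeries.C z + PowerSeries.X) := by
  let t : L → PowerSeries L := fun z => .mk fun n => D^[n] z / (n.factorial : L)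
  have hts : ∀ z (n : ℕ), ((n : L) + 1) * PowerSeries.coeff (n + 1) (t z) =
      PowerSeries.coeff n (t (D z)) := fun z n => by
    have h1 : ((n : L) + 1) ≠ 0 := by exact_mod_cast n.succ_ne_zero
    have h2 : (n.factorial : L) ≠ 0 := by exact_mod_cast n.factorial_ne_zero
    simp only [t, PowerSeries.coeff_mk, Function.iterate_succ_apply, Nat.factorial_succ]
    push_cast
    field_simp
  have hd : ∀ z, PowerSeries.derivative L (t z) = t (D z) := fun z => by
    ext n
    rw [← hts, PowerSeries.coeff_derivative, mul_comm]
  have hadd : ∀ z w, t (z + w) = t z + t w := fun z w => by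
    ext n
    simp [t, iterate_map_add, add_div]
  have hmul : ∀ n z w, PowerSeries.coeff n (t (z * w)) = PowerSeries.coeff n (t z * t w) := by
    intro n
    induction n with
    | zero => intro z w; simp [t]
    | succ n ih =>
      intro z w
      have h1 : ((n : L) + 1) ≠ 0 := by exact_mod_cast n.succ_ne_zero
      apply mul_left_cancel₀ h1
      rw [hts, Derivation.leibniz, hadd, map_add, smul_eq_mul, smul_eq_mul, ih, ih, ← map_add,
        ← hd, ← hd, ← smul_eq_mul, ← smul_eq_mul, ← Derivation.leibniz,
        PowerSeries.coeff_derivative, mul_comm]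
  have hz : ∀ z, D z = 0 → t z = PowerSeries.C z := fun z hz => by
    ext n
    rcases n with _ | n
    · simp [t]
    · simp [t, hz]
  have h0 : t 0 = 0 := by rw [hz 0 (map_zero D), map_zero]
  have h1 : t 1 = 1 := by rw [hz 1 D.map_one_eq_zero, map_one]
  refine ⟨⟨⟨⟨t, h1⟩, fun z w => PowerSeries.ext fun n => hmul n z w⟩, h0, hadd⟩, hz, ?_⟩
  intro z hz
  change t z = _
  ext n
  rcases n with _ | _ | n
  · simp [t]
  · simp [t, hz]
  · simp [t, hz, PowerSeries.coeff_X, D.map_one_eq_zero]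

/-- Away from a countable set of points `x`, there is a derivation of `ℝ` that is constant on a
given countable set and maps `x` to `1`. -/
lemma exists_derivation_of_notMem_countable {s : Set ℝ} (hs : s.Countable) :
    ∃ t : Set ℝ, t.Countable ∧ ∀ x ∉ t, ∃ D : Derivation ℚ ℝ ℝ, (∀ z ∈ s, D z = 0) ∧ D x = 1 := by
  let K := IntermediateField.adjoin ℚ s
  have : Countable K := by
    rw [← Cardinal.mk_le_aleph0_iff]
    refine (IntermediateField.cardinalMk_adjoin_le ℚ s).trans ?_
    simpa using hs
  refine ⟨{x | IsAlgebraic K x}, Algebraic.countable K ℝ, fun x hx => ?_⟩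
  obtain ⟨D, hD⟩ := exists_derivation_apply_eq_one (K := K) (x := x) hx
  refine ⟨D.restrictScalars ℚ, fun z hz => ?_, hD⟩
  exact D.map_algebraMap ⟨z, IntermediateField.subset_adjoin ℚ s hz⟩

/-- An open set contains points having a generic Taylor expansion, as a ring homomorphism on
all of `ℝ` which is constant on a given countable set. -/
lemma exists_generic_taylor {s : Set ℝ} (hs : s.Countable) {V : Set (Fin 2 → ℝ)}
    (hV : (interior V).Nonempty) :
    ∃ p ∈ V, ∃ τ : ℝ →+* PowerSeries (PowerSeries ℝ),
      (∀ z ∈ s, τ z = PowerSeries.C (PowerSeries.C z)) ∧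
      τ (p 0) = PowerSeries.C (PowerSeries.C (p 0)) + PowerSeries.X ∧
      τ (p 1) = PowerSeries.C (PowerSeries.C (p 1)) + PowerSeries.C PowerSeries.X := by
  obtain ⟨q, hq⟩ := hV
  obtain ⟨ε, hε, hball⟩ := Metric.isOpen_iff.1 isOpen_interior q hq
  obtain ⟨t, ht, hD⟩ := exists_derivation_of_notMem_countable hs
  obtain ⟨a, hat, ha⟩ := (ht.dense_compl ℝ).exists_dist_lt (q 0) hε
  obtain ⟨t', ht', hD'⟩ := exists_derivation_of_notMem_countable (hs.insert a)
  obtain ⟨b, hbt, hb⟩ := (ht'.dense_compl ℝ).exists_dist_lt (q 1) hε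
  obtain ⟨D₁, hD₁, hD₁a⟩ := hD a hat
  obtain ⟨D₂, hD₂, hD₂b⟩ := hD' b hbt
  obtain ⟨τ₁, h₁, h₁'⟩ := (D₁ - D₁ b • D₂).exists_taylor
  obtain ⟨τ₂, h₂, h₂'⟩ := D₂.exists_taylor
  have hD₂a : D₂ a = 0 := hD₂ a (Set.mem_insert _ _)
  refine ⟨![a, b], interior_subset (hball ?_), (PowerSeries.map τ₂).comp τ₁, ?_, ?_, ?_⟩
  · rw [Metric.mem_ball, dist_pi_lt_iff hε]
    intro i
    fin_cases i
    · simpa [dist_comm] using ha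
    · simpa [dist_comm] using hb
  · intro z hz
    have hz₂ : D₂ z = 0 := hD₂ z (Set.mem_insert_of_mem _ hz)
    simp [h₁ z (by simp [hD₁ z hz, hz₂]), h₂ z hz₂]
  · simp [h₁' a (by simp [hD₁a, hD₂a]), h₂ a hD₂a]
  · simp [h₁ b (by simp [hD₂b]), h₂' b hD₂b]

/-- The coefficient of `x ^ i * y ^ j` in the Motzkin polynomial
`y ^ 2 + y ^ 4 + x ^ 6 - 3 * x ^ 2 * y ^ 2`. -/
def motzkinCoeff (i j : ℕ) : ℝ :=
  (if i = 0 ∧ j = 2 then 1 else 0) + (if i = 0 ∧ j = 4 then 1 else 0) +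
    (if i = 6 ∧ j = 0 then 1 else 0) - 3 * (if i = 2 ∧ j = 2 then 1 else 0)

open Polynomial in
/-- If a sum of squares of real polynomials has degree at most `2 * m`, then every summand is the
square of a polynomial of degree at most `m`. -/
lemma natDegree_le_of_natDegree_sum_sq_le {Λ : Type*} [Fintype Λ] {p : Λ → ℝ[X]} {m : ℕ}
    (h : (∑ l, p l ^ 2).natDegree ≤ 2 * m) (l : Λ) : (p l).natDegree ≤ m := by
  have key : ∀ k, (∀ l, (p l).natDegree ≤ m + k) → ∀ l, (p l).natDegree ≤ m := by
    intro k
    induction k with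
    | zero => exact fun h => h
    | succ k ih =>
      intro hk
      refine ih fun l => ?_
      have hsum : ∑ l, (p l).coeff (m + (k + 1)) ^ 2 = 0 := by
        have h0 : (∑ l, p l ^ 2).coeff (2 * (m + (k + 1))) = 0 :=
          coeff_eq_zero_of_natDegree_lt (by omega)
        rw [finsetSum_coeff] at h0
        rw [← h0]
        exact Finset.sum_congr rfl fun l _ => (coeff_pow_of_natDegree_le (hk l)).symm
      have hl := (Finset.sum_eq_zero_iff_of_nonneg fun l _ => sq_nonneg _).1 hsum l
        (Finset.mem_univ l)
      exact natDegree_le_pred (hk l) (pow_eq_zero_iff two_ne_zero |>.1 hl)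
  exact key (Finset.univ.sup fun l => (p l).natDegree)
    (fun l => (Finset.le_sup (f := fun l => (p l).natDegree) (Finset.mem_univ l)).trans
      (Nat.le_add_left _ _)) l

open Polynomial in
/-- No positive multiple of the Motzkin polynomial is a sum of squares of polynomials, and a sum of
squares of polynomials vanishes only if all of its summands do. Polynomials are given by their
coefficients `W l i j`. -/
lemma eq_zero_of_sum_sq_eq_motzkin {Λ : Type*} [Fintype Λ] {N : ℕ} {W : Λ → ℕ → ℕ → ℝ} {μ : ℝ}
    (hμ : 0 ≤ μ) (hW : ∀ l i j, N ≤ i + j → W l i j = 0)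
    (h : ∀ i j, ∑ l, ∑ p ∈ Finset.HasAntidiagonal.antidiagonal i, ∑ q ∈ Finset.HasAntidiagonal.antidiagonal j,
      W l p.1 q.1 * W l p.2 q.2 = μ * motzkinCoeff i j) :
    μ = 0 ∧ ∀ l i j, W l i j = 0 := by
  let Q : Λ → ℝ[X][X] := fun l =>
    ∑ i ∈ Finset.range N, ∑ j ∈ Finset.range N, monomial i (monomial j (W l i j))
  let F : ℝ[X][X] := C (X ^ 2) + C (X ^ 4) + X ^ 6 - 3 * (X ^ 2 * C (X ^ 2))
  have hQ : ∀ l i j, ((Q l).coeff i).coeff j = W l i j := by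
    intro l i j
    simp only [Q, finsetSum_coeff, coeff_monomial]
    simp only [apply_ite (fun r : ℝ[X] => r.coeff j), coeff_monomial, coeff_zero]
    by_cases hij : i < N ∧ j < N
    · simp [hij.1, hij.2]
    · rw [hW l i j (by omega)]
      refine Finset.sum_eq_zero fun a _ => Finset.sum_eq_zero fun b _ => ?_
      split_ifs with h1 h2
      · subst h1 h2; exact hW _ _ _ (by omega)
      all_goals rfl
  have hF : ∀ i j, (F.coeff i).coeff j = motzkinCoeff i j := by
    intro i j
    have h22 : (3 * (X ^ 2 * C (X ^ 2)) : ℝ[X][X]) = monomial 2 (monomial 2 3) := by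
      simp only [← C_mul_X_pow_eq_monomial, map_mul, map_pow, map_ofNat]
      ring
    simp only [F, h22, coeff_add, coeff_sub, coeff_monomial, coeff_X_pow, coeff_C, motzkinCoeff,
      apply_ite (fun r : ℝ[X] => r.coeff j), coeff_one, coeff_zero]
    congr 1
    · congr 1
      · congr 1 <;> split_ifs <;> first | rfl | omega
      · split_ifs <;> first | rfl | omega
    · split_ifs <;> first | omega | simp
  have hsum : ∑ l, Q l ^ 2 = C (C μ) * F := by
    ext i j
    rw [coeff_C_mul, coeff_C_mul, hF, ← h, finsetSum_coeff, finsetSum_coeff]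
    simp only [pow_two, coeff_mul, finsetSum_coeff, hQ]
  have sq_zero : ∀ r : Λ → ℝ, ∑ l, r l ^ 2 = 0 → ∀ l, r l = 0 := fun r hr l =>
    pow_eq_zero_iff two_ne_zero |>.1 <|
      (Finset.sum_eq_zero_iff_of_nonneg fun l _ => sq_nonneg _).1 hr l (Finset.mem_univ l)
  have h00 : ∀ l, W l 0 0 = 0 := sq_zero _ <| by
    simpa [motzkinCoeff, pow_two] using h 0 0
  have h10 : ∀ l, W l 1 0 = 0 := sq_zero _ <| by
    simpa [motzkinCoeff, pow_two, Finset.Nat.antidiagonal_succ, h00] using h 2 0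
  have h20 : ∀ l, W l 2 0 = 0 := sq_zero _ <| by
    simpa [motzkinCoeff, pow_two, Finset.Nat.antidiagonal_succ, h00, h10] using h 4 0
  let ψ : ℝ[X][X] →+* ℝ[X] := eval₂RingHom (compRingHom (X ^ 3)) (X ^ 2)
  have hψC : ∀ p : ℝ[X], ψ (C p) = p.comp (X ^ 3) := fun p => eval₂_C _ _
  have hψX : ψ X = X ^ 2 := eval₂_X _ _
  have hψF : ψ F = X ^ 6 + X ^ 12 + X ^ 12 - 3 * (X ^ 4 * X ^ 6) := by
    simp only [F, map_add, map_sub, map_mul, hψC, map_pow ψ, hψX, map_ofNat]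
    simp [← pow_mul]
  have hψQ : ∀ l, ψ (Q l) = ∑ i ∈ Finset.range N, ∑ j ∈ Finset.range N,
      monomial (2 * i + 3 * j) (W l i j) := by
    intro l
    simp only [Q, map_sum]
    refine Finset.sum_congr rfl fun i _ => Finset.sum_congr rfl fun j _ => ?_
    simp only [← C_mul_X_pow_eq_monomial, map_mul ψ, map_pow ψ, hψC, hψX]
    simp only [mul_comp, C_comp, pow_comp, X_comp, ← pow_mul, pow_add]
    ring
  have h21 : ∀ l, W l 2 1 = 0 := by
    intro l
    by_cases hN : N ≤ 2 + 1
    · exact hW _ _ _ hN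
    have hdeg : (∑ l, ψ (Q l) ^ 2).natDegree ≤ 2 * 6 := by
      simp only [← map_pow, ← map_sum]
      rw [hsum, map_mul, hψF, hψC, C_comp]
      compute_degree
    have h7 : (ψ (Q l)).coeff 7 = 0 := coeff_eq_zero_of_natDegree_lt <|
      (natDegree_le_of_natDegree_sum_sq_le hdeg l).trans_lt (by norm_num)
    rw [hψQ] at h7
    simp only [finsetSum_coeff, coeff_monomial] at h7
    rw [← h7, Finset.sum_eq_single 2, Finset.sum_eq_single 1]
    · simp
    · intro j _ hj
      exact if_neg (by omega)
    · simp; omega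
    · intro i _ hi
      exact Finset.sum_eq_zero fun j _ => if_neg (by omega)
    · simp; omega
  have hμ0 : μ = 0 := by
    have h22 := h 2 2
    simp [motzkinCoeff, Finset.Nat.antidiagonal_succ, h00, h10, h20, h21] at h22
    have : 0 ≤ ∑ l, W l 1 1 * W l 1 1 := Finset.sum_nonneg fun l _ => mul_self_nonneg _
    linarith
  refine ⟨hμ0, fun l i j => ?_⟩
  have hev : ∀ x y : ℝ, evalEval y x (Q l) = 0 := by
    intro x y
    refine sq_zero (fun l => evalEval y x (Q l)) ?_ l
    have := congrArg (evalEvalRingHom y x) hsum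
    simpa [hμ0, evalEval_pow] using this
  rw [← hQ]
  have : Q l = 0 := by
    refine eq_zero_of_infinite_isRoot _
      ((Set.infinite_range_of_injective (C_injective (R := ℝ))).mono ?_)
    rintro _ ⟨y, rfl⟩
    exact Polynomial.funext fun x => by simpa [evalEval] using hev y x
  simp [this]

/-- The coefficient of `s ^ i * t ^ j` of an iterated power series, as a linear functional. -/
noncomputable def iterCoeff (i j : ℕ) : PowerSeries (PowerSeries ℝ) →ₗ[ℝ] ℝ where
  toFun f := PowerSeries.coeff j (PowerSeries.coeff i f)
  map_add' f g := by simp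
  map_smul' a f := by simp

/-- On a finite-dimensional space of iterated power series, all coefficients are linear
combinations of the coefficients of bounded total degree. -/
lemma exists_iterCoeff_eq_sum (U : Submodule ℝ (PowerSeries (PowerSeries ℝ)))
    [FiniteDimensional ℝ U] :
    ∃ N : ℕ, 4 ≤ N ∧ ∃ T : Finset (ℕ × ℕ), (∀ n ∈ T, n.1 + n.2 < N) ∧
      ∃ g : ℕ → ℕ → ℕ × ℕ → ℝ, ∀ u ∈ U, ∀ i j,
        iterCoeff i j u = ∑ n ∈ T, g i j n * iterCoeff n.1 n.2 u := by
  classical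
  let e : ℕ × ℕ → Module.Dual ℝ U := fun n => (iterCoeff n.1 n.2).comp U.subtype
  obtain ⟨T, hT⟩ : ∃ T : Finset (ℕ × ℕ),
      Submodule.span ℝ (e '' T) = Submodule.span ℝ (Set.range e) := by
    obtain ⟨t, ht, hts⟩ := Submodule.fg_span_iff_fg_span_finset_subset (Set.range e) |>.1
      (IsNoetherian.noetherian (Submodule.span ℝ (Set.range e)))
    rw [← Set.image_univ] at ht
    obtain ⟨T, -, hT⟩ := Finset.subset_set_image_iff.1 ht
    exact ⟨T, by rw [hts, ← hT, Finset.coe_image]⟩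
  choose g hg using fun n : ℕ × ℕ =>
    Submodule.mem_span_image_finset_iff_exists_fun' ℝ |>.1
      (hT.symm ▸ Submodule.subset_span (Set.mem_range_self n) :
        e n ∈ Submodule.span ℝ (e '' T))
  refine ⟨T.sup (fun n => n.1 + n.2) + 4, by omega, T, fun n hn => ?_,
    fun i j n => g (i, j) n, fun u hu i j => ?_⟩
  · have := Finset.le_sup (f := fun n : ℕ × ℕ => n.1 + n.2) hn
    omega
  · have := LinearMap.congr_fun (hg (i, j)) ⟨u, hu⟩
    simpa [e] using this.symm

open Filter Topology in
/-- Sums of squares whose coefficients of order at least `N` are negligible compared to the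
remaining ones do not converge to the Motzkin polynomial. -/
lemma not_sum_sq_approximates_motzkinCoeff {Λ : Type*} [Fintype Λ] {N : ℕ} (hN : 4 ≤ N)
    {c : ℕ → ℝ} (hc : Tendsto c atTop (𝓝 0)) {v : ℕ → Λ → ℕ → ℕ → ℝ} {B : ℕ → ℕ → ℝ}
    (hv : ∀ i j, N ≤ i + j → ∀ k l R, (∀ a b, a + b < N → |v k l a b| ≤ R) →
      |v k l i j| ≤ c k * B i j * R)
    (hsq : ∀ k i j, i + j < 2 * N →
      |∑ l, ∑ p ∈ Finset.HasAntidiagonal.antidiagonal i,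
        ∑ q ∈ Finset.HasAntidiagonal.antidiagonal j, v k l p.1 q.1 * v k l p.2 q.2
          - motzkinCoeff i j| ≤ c k) : False := by
  let S := (Finset.range N ×ˢ Finset.range N).filter fun n => n.1 + n.2 < N
  have hS : ∀ a b, (a, b) ∈ S ↔ a + b < N := by
    intro a b
    simp only [S, Finset.mem_filter, Finset.mem_product, Finset.mem_range]
    omega
  let E : ℕ → ℝ := fun k => 1 + ∑ l, ∑ n ∈ S, v k l n.1 n.2 ^ 2
  let D : ℕ → ℝ := fun k => √(E k)
  have hE : ∀ k, 1 ≤ E k := fun k => le_add_of_nonneg_right <|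
    Finset.sum_nonneg fun l _ => Finset.sum_nonneg fun n _ => sq_nonneg _
  have hD : ∀ k, 1 ≤ D k := fun k => Real.one_le_sqrt.2 (hE k)
  have hD0 : ∀ k, 0 < D k := fun k => one_pos.trans_le (hD k)
  have hDE : ∀ k, D k ^ 2 = E k := fun k => Real.sq_sqrt (zero_le_one.trans (hE k))
  have hlow : ∀ k l a b, a + b < N → |v k l a b| ≤ D k := by
    intro k l a b hab
    refine Real.abs_le_sqrt ?_
    calc v k l a b ^ 2 ≤ ∑ n ∈ S, v k l n.1 n.2 ^ 2 :=
          Finset.single_le_sum (f := fun n => v k l n.1 n.2 ^ 2) (fun n _ => sq_nonneg _)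
            ((hS a b).2 hab)
      _ ≤ ∑ l, ∑ n ∈ S, v k l n.1 n.2 ^ 2 :=
          Finset.single_le_sum (f := fun l => ∑ n ∈ S, v k l n.1 n.2 ^ 2)
            (fun l _ => Finset.sum_nonneg fun n _ => sq_nonneg _) (Finset.mem_univ l)
      _ ≤ E k := le_add_of_nonneg_left zero_le_one
  let W : ℕ → Λ → ℕ → ℕ → ℝ := fun k l i j => v k l i j / D k
  have hWlow : ∀ k l a b, a + b < N → |W k l a b| ≤ 1 := by
    intro k l a b hab
    rw [abs_div, abs_of_pos (hD0 k)]
    exact div_le_one_of_le₀ (hlow k l a b hab) (hD0 k).le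
  have hWhigh : ∀ k l i j, N ≤ i + j → |W k l i j| ≤ c k * B i j := by
    intro k l i j hij
    rw [abs_div, abs_of_pos (hD0 k), div_le_iff₀ (hD0 k)]
    exact hv i j hij k l _ (hlow k l)
  have hω : (hyperfilter ℕ : Filter ℕ) ≤ atTop := by
    rw [← Nat.cofinite_eq_atTop]; exact hyperfilter_le_cofinite
  have hcω := hc.mono_left hω
  have lim : ∀ x : ℕ → ℝ, (∀ k, |x k| ≤ 1) →
      ∃ y, Tendsto x (hyperfilter ℕ : Filter ℕ) (𝓝 y) := by
    intro x hx
    obtain ⟨y, -, hy⟩ := isCompact_Icc.ultrafilter_le_nhds ((hyperfilter ℕ).map x)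
      (s := Set.Icc (-1 : ℝ) 1)
      (le_principal_iff.2 (show x ⁻¹' Set.Icc (-1) 1 ∈ hyperfilter ℕ from univ_mem' fun k => abs_le.1 (hx k)))
    exact ⟨y, hy⟩
  have hW : ∀ l i j, ∃ y, Tendsto (fun k => W k l i j) (hyperfilter ℕ : Filter ℕ) (𝓝 y) ∧
      (N ≤ i + j → y = 0) := by
    intro l i j
    by_cases hij : i + j < N
    · obtain ⟨y, hy⟩ := lim (fun k => W k l i j) fun k => hWlow k l i j hij
      exact ⟨y, hy, fun h => absurd hij (not_lt.2 h)⟩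
    · refine ⟨0, squeeze_zero_norm (fun k => hWhigh k l i j (not_lt.1 hij)) ?_, fun _ => rfl⟩
      simpa using hcω.mul_const (B i j)
  choose Y hY hY0 using hW
  obtain ⟨μ, hμ⟩ := lim (fun k => 1 / E k) fun k => by
    rw [abs_of_nonneg (by have := hE k; positivity)]
    exact div_le_one_of_le₀ (hE k) (zero_le_one.trans (hE k))
  have hμ0 : 0 ≤ μ := ge_of_tendsto' hμ fun k => by have := hE k; positivity
  have key := eq_zero_of_sum_sq_eq_motzkin hμ0 hY0 fun i j => by
    by_cases hij : i + j < 2 * N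
    · have h1 : Tendsto (fun k => ∑ l, ∑ p ∈ Finset.HasAntidiagonal.antidiagonal i,
          ∑ q ∈ Finset.HasAntidiagonal.antidiagonal j, W k l p.1 q.1 * W k l p.2 q.2)
          (hyperfilter ℕ : Filter ℕ) (𝓝 (∑ l, ∑ p ∈ Finset.HasAntidiagonal.antidiagonal i,
          ∑ q ∈ Finset.HasAntidiagonal.antidiagonal j, Y l p.1 q.1 * Y l p.2 q.2)) :=
        tendsto_finsetSum _ fun l _ => tendsto_finsetSum _ fun p _ =>
          tendsto_finsetSum _ fun q _ => (hY _ _ _).mul (hY _ _ _)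
      have h2 := h1.sub (hμ.mul_const (motzkinCoeff i j))
      refine sub_eq_zero.1 (tendsto_nhds_unique h2 (squeeze_zero_norm (fun k => ?_) hcω))
      have h3 : ∑ l, ∑ p ∈ Finset.HasAntidiagonal.antidiagonal i,
          ∑ q ∈ Finset.HasAntidiagonal.antidiagonal j, W k l p.1 q.1 * W k l p.2 q.2
          - 1 / E k * motzkinCoeff i j = (∑ l, ∑ p ∈ Finset.HasAntidiagonal.antidiagonal i,
          ∑ q ∈ Finset.HasAntidiagonal.antidiagonal j, v k l p.1 q.1 * v k l p.2 q.2
          - motzkinCoeff i j) / E k := by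
        simp only [W, div_mul_div_comm, ← pow_two, hDE, ← Finset.sum_div]
        ring
      rw [h3, Real.norm_eq_abs, abs_div, abs_of_pos (one_pos.trans_le (hE k))]
      exact (div_le_self (abs_nonneg _) (hE k)).trans (hsq k i j hij)
    · rw [motzkinCoeff, if_neg (by omega), if_neg (by omega), if_neg (by omega),
        if_neg (by omega)]
      simp only [add_zero, mul_zero, sub_zero]
      refine Finset.sum_eq_zero fun l _ => Finset.sum_eq_zero fun p hp =>
        Finset.sum_eq_zero fun q hq => ?_
      rw [Finset.HasAntidiagonal.mem_antidiagonal] at hp hq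
      by_cases h : N ≤ p.1 + q.1
      · rw [hY0 l _ _ h, zero_mul]
      · rw [hY0 l p.2 q.2 (by omega), mul_zero]
  have h1 : Tendsto (fun k => 1 / E k + ∑ l, ∑ n ∈ S, W k l n.1 n.2 ^ 2)
      (hyperfilter ℕ : Filter ℕ) (𝓝 (μ + ∑ l, ∑ n ∈ S, Y l n.1 n.2 ^ 2)) :=
    hμ.add (tendsto_finsetSum _ fun l _ => tendsto_finsetSum _ fun n _ => (hY _ _ _).pow 2)
  have h2 : (fun k => 1 / E k + ∑ l, ∑ n ∈ S, W k l n.1 n.2 ^ 2) = fun _ => 1 := by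
    funext k
    simp only [W, div_pow, hDE, ← Finset.sum_div, ← add_div]
    exact div_self (one_pos.trans_le (hE k)).ne'
  rw [h2] at h1
  have h3 := tendsto_nhds_unique h1 tendsto_const_nhds
  simp [key] at h3

/-- A finite-dimensional space of power series does not contain approximate sum of squares
representations of all the rescaled Motzkin polynomials. -/
lemma not_sum_sq_approximates_scaled_motzkin {Λ : Type*} [Fintype Λ]
    (U : Submodule ℝ (PowerSeries (PowerSeries ℝ))) [FiniteDimensional ℝ U]
    (h : ∀ (M : ℕ) (c ε : ℝ), 0 < c → c ≤ 1 → 0 < ε → ∃ u : Λ → PowerSeries (PowerSeries ℝ),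
      (∀ l, u l ∈ U) ∧ ∀ i j, i + j < M →
        |c ^ (i + j) * iterCoeff i j (∑ l, u l ^ 2) - c ^ 6 * motzkinCoeff i j| < ε) : False := by
  obtain ⟨N, hN, T, hT, g, hg⟩ := exists_iterCoeff_eq_sum U
  let c : ℕ → ℝ := fun k => 1 / ((k : ℝ) + 1)
  have hc : ∀ k, 0 < c k := fun k => by positivity
  have hc1 : ∀ k, c k ≤ 1 := fun k => by
    refine div_le_one_of_le₀ ?_ ?_ <;> linarith [Nat.cast_nonneg (α := ℝ) k]
  choose u hu hsq using fun k => h (2 * N) (c k) (c k ^ 7) (hc k) (hc1 k) (pow_pos (hc k) 7)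
  refine not_sum_sq_approximates_motzkinCoeff hN (c := c) tendsto_one_div_add_atTop_nhds_zero_nat
    (v := fun k l i j => c k ^ (i + j) * iterCoeff i j (u k l) / c k ^ 3)
    (B := fun i j => ∑ n ∈ T, |g i j n|) ?_ ?_
  · intro i j hij k l R hR
    have hR0 : 0 ≤ R := (abs_nonneg _).trans (hR 0 0 (by omega))
    rw [hg _ (hu k l), Finset.mul_sum, Finset.sum_div]
    refine (Finset.abs_sum_le_sum_abs _ _).trans ?_
    rw [Finset.mul_sum, Finset.sum_mul]
    refine Finset.sum_le_sum fun n hn => ?_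
    obtain ⟨r, hr⟩ := Nat.exists_eq_add_of_lt ((hT n hn).trans_le hij)
    have hpow : c k ^ (r + 1) ≤ c k := pow_le_of_le_one (hc k).le (hc1 k) (by omega)
    calc |c k ^ (i + j) * (g i j n * iterCoeff n.1 n.2 (u k l)) / c k ^ 3|
        = c k ^ (r + 1) * |g i j n| *
          |c k ^ (n.1 + n.2) * iterCoeff n.1 n.2 (u k l) / c k ^ 3| := by
          nth_rw 1 [← abs_of_pos (pow_pos (hc k) (r + 1))]
          rw [← abs_mul, ← abs_mul, hr]
          ring_nf
      _ ≤ c k * |g i j n| * R := by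
          gcongr
          exact hR _ _ (hT n hn)
  · intro k i j hij
    have hc6 := pow_pos (hc k) 6
    have h1 : ∑ l, ∑ p ∈ Finset.HasAntidiagonal.antidiagonal i,
        ∑ q ∈ Finset.HasAntidiagonal.antidiagonal j,
          c k ^ (p.1 + q.1) * iterCoeff p.1 q.1 (u k l) / c k ^ 3 *
            (c k ^ (p.2 + q.2) * iterCoeff p.2 q.2 (u k l) / c k ^ 3) =
        c k ^ (i + j) * iterCoeff i j (∑ l, u k l ^ 2) / c k ^ 6 := by
      simp only [map_sum, Finset.mul_sum, Finset.sum_div]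
      refine Finset.sum_congr rfl fun l _ => ?_
      have : iterCoeff i j (u k l ^ 2) = ∑ p ∈ Finset.HasAntidiagonal.antidiagonal i,
          ∑ q ∈ Finset.HasAntidiagonal.antidiagonal j,
            iterCoeff p.1 q.1 (u k l) * iterCoeff p.2 q.2 (u k l) := by
        simp [iterCoeff, pow_two, PowerSeries.coeff_mul]
      simp only [this, Finset.mul_sum, Finset.sum_div]
      refine Finset.sum_congr rfl fun p hp => Finset.sum_congr rfl fun q hq => ?_
      rw [Finset.HasAntidiagonal.mem_antidiagonal] at hp hq
      rw [← hp, ← hq, div_mul_div_comm]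
      ring
    have h2 := (hsq k i j hij).le
    rw [h1, div_sub' hc6.ne', abs_div, abs_of_pos hc6, div_le_iff₀ hc6]
    calc _ ≤ c k ^ 7 := h2
      _ = c k * c k ^ 6 := by ring

open Matrix in
/-- Conic duality: a linear functional that is nonnegative on the feasible set of a homogeneous
linear matrix inequality is a limit of functionals given by positive semidefinite multipliers. -/
lemma mem_closure_trace_mul_of_forall_posSemidef {ι n : Type*} [Fintype ι] [Fintype n]
    {G : ι → Matrix n n ℝ} (hG : ∀ i, (G i).IsSymm) {z : ι → ℝ}
    (h : ∀ x : ι → ℝ, (∑ i, x i • G i).PosSemidef → 0 ≤ ∑ i, x i * z i) :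
    z ∈ closure {w : ι → ℝ | ∃ Q : Matrix n n ℝ, Q.PosSemidef ∧ w = fun i => (Q * G i).trace} := by
  classical
  set s := {w : ι → ℝ | ∃ Q : Matrix n n ℝ, Q.PosSemidef ∧ w = fun i => (Q * G i).trace}
  have hs : Convex ℝ s := by
    rintro _ ⟨Q, hQ, rfl⟩ _ ⟨R, hR, rfl⟩ a b ha hb -
    refine ⟨a • Q + b • R, (hQ.smul ha).add (hR.smul hb), ?_⟩
    ext i
    simp [add_mul, trace_add]
  by_contra hz
  obtain ⟨f, u, hf, hu⟩ := geometric_hahn_banach_closed_point hs.closure isClosed_closure hz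
  have hu0 : 0 < u := by
    simpa using hf 0 (subset_closure ⟨0, PosSemidef.zero, by ext; simp⟩)
  have hfs : ∀ w ∈ s, f w ≤ 0 := by
    rintro _ ⟨Q, hQ, rfl⟩
    by_contra! hpos
    set w : ι → ℝ := fun i => (Q * G i).trace
    have := hf ((u / f w) • w) (subset_closure ⟨(u / f w) • Q, hQ.smul (by positivity), by
      ext; simp [w]⟩)
    rw [map_smul, smul_eq_mul, div_mul_cancel₀ _ hpos.ne'] at this
    exact this.false
  have hfx : ∀ w : ι → ℝ, f w = ∑ i, f (Pi.single i 1) * w i := fun w => by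
    conv_lhs => rw [pi_eq_sum_univ' w]
    simp [mul_comm]
  have hx := h (fun i => -f (Pi.single i 1)) ?_
  · simp only [neg_mul, Finset.sum_neg_distrib, ← hfx] at hx
    linarith
  · refine PosSemidef.of_dotProduct_mulVec_nonneg ?_ fun v => ?_
    · rw [IsHermitian, conjTranspose_sum]
      exact Finset.sum_congr rfl fun i _ => by
        rw [conjTranspose_smul, conjTranspose_eq_transpose_of_trivial, hG i, star_trivial]
    · have := hfs _ ⟨vecMulVec v (star v), posSemidef_vecMulVec_self_star v, rfl⟩
      rw [hfx] at this
      simp only [vecMulVec_mul, trace_vecMulVec, star_trivial, ← dotProduct_mulVec,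
        dotProduct_comm v (v ᵥ* _)] at this
      simp only [sum_mulVec, smul_mulVec, dotProduct_sum, dotProduct_smul, smul_eq_mul, neg_mul,
        Finset.sum_neg_distrib, star_trivial]
      linarith

open scoped MatrixOrder in
/-- A real positive semidefinite matrix is a Gram matrix. -/
lemma Matrix.PosSemidef.exists_eq_transpose_mul_self {n : Type*} [Fintype n] {M : Matrix n n ℝ}
    (hM : M.PosSemidef) : ∃ H : Matrix n n ℝ, M = H.transpose * H := by
  classical
  obtain ⟨H, hH⟩ := CStarAlgebra.nonneg_iff_eq_star_mul_self.1 (Matrix.nonneg_iff_posSemidef.2 hM)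
  exact ⟨H, hH⟩

/-- The homogeneous coordinate vector of `z₀ + ∑ i, z i * ξ i + ∑ j, y j * η j`. -/
def homogenize {κ μ R : Type*} (z₀ : R) (z : κ → R) (y : μ → R) : Option (κ ⊕ μ) → R :=
  fun o => o.elim z₀ (Sum.elim z y)

open Matrix in
/-- A nonempty spectrahedral shadow is defined by a homogeneous linear matrix pencil for which every
affine functional that is nonnegative on the shadow is a limit of functionals certified by
positive semidefinite multipliers. -/
lemma IsSpectrahedralShadow.exists_pencil {k : ℕ} {K : Set (Fin k → ℝ)}
    (hK : IsSpectrahedralShadow K) (hne : K.Nonempty) :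
    ∃ (n m : ℕ) (G : Option (Fin k ⊕ Fin m) → Matrix (Fin n ⊕ Unit) (Fin n ⊕ Unit) ℝ),
      (∀ ξ ∈ K, ∃ η : Fin m → ℝ, (∑ o, homogenize 1 ξ η o • G o).PosSemidef) ∧
      ∀ (z₀ : ℝ) (z : Fin k → ℝ), (∀ ξ ∈ K, 0 ≤ z₀ + ∑ i, z i * ξ i) →
        homogenize z₀ z 0 ∈ closure {w : Option (Fin k ⊕ Fin m) → ℝ |
          ∃ Q : Matrix (Fin n ⊕ Unit) (Fin n ⊕ Unit) ℝ,
            Q.PosSemidef ∧ w = fun o => (Q * G o).trace} := by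
  obtain ⟨n, m, -, A, B, C, hA, hB, hC, rfl⟩ := hK
  let G : Option (Fin k ⊕ Fin m) → Matrix (Fin n ⊕ Unit) (Fin n ⊕ Unit) ℝ :=
    homogenize (fromBlocks A 0 0 1) (fun i => fromBlocks (B i) 0 0 0)
      (fun j => fromBlocks (C j) 0 0 0)
  have hGsum : ∀ x : Option (Fin k ⊕ Fin m) → ℝ, ∑ o, x o • G o = fromBlocks
      (x none • A + ∑ i, x (some (.inl i)) • B i + ∑ j, x (some (.inr j)) • C j) 0 0
      (x none • 1) := by
    intro x
    simp only [Fintype.sum_option, Fintype.sum_sum_type, G, homogenize, Option.elim,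
      Sum.elim_inl, Sum.elim_inr, fromBlocks_smul, smul_zero, add_assoc]
    ext (i | i) (j | j) <;> simp [Matrix.sum_apply]
  refine ⟨n, m, G, ?_, ?_⟩
  · rintro ξ ⟨η, h⟩
    refine ⟨η, ?_⟩
    rw [hGsum]
    simp only [homogenize, Option.elim, Sum.elim_inl, Sum.elim_inr, one_smul]
    obtain ⟨H, hH⟩ := h.exists_eq_transpose_mul_self
    have := posSemidef_conjTranspose_mul_self (fromBlocks H 0 0 (1 : Matrix Unit Unit ℝ))
    simpa [fromBlocks_transpose, fromBlocks_multiply, hH] using this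
  · intro z₀ z hz
    obtain ⟨ξ₀, η₀, h₀⟩ := hne
    refine mem_closure_trace_mul_of_forall_posSemidef ?_ fun x hx => ?_
    · rintro (_ | i | j)
      · exact hA.fromBlocks (transpose_zero) isSymm_one
      · exact (hB i).fromBlocks (transpose_zero) isSymm_zero
      · exact (hC j).fromBlocks (transpose_zero) isSymm_zero
    · rw [hGsum] at hx
      set t := x none
      set ξ : Fin k → ℝ := fun i => x (some (.inl i))
      set η : Fin m → ℝ := fun j => x (some (.inr j))
      have ht : 0 ≤ t := by simpa using hx.diag_nonneg (i := Sum.inr ())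
      have hM : (t • A + ∑ i, ξ i • B i + ∑ j, η j • C j).PosSemidef := hx.submatrix Sum.inl
      have hb : ∀ s : ℝ, 0 ≤ s →
          0 ≤ (z₀ + ∑ i, z i * ξ₀ i) + s * (z₀ * t + ∑ i, z i * ξ i) := by
        intro s hs
        have hst : 0 < 1 + s * t := by positivity
        have := hz ((1 + s * t)⁻¹ • (ξ₀ + s • ξ)) ⟨(1 + s * t)⁻¹ • (η₀ + s • η), ?_⟩
        · have h2 := mul_nonneg hst.le this
          have h3 : (1 + s * t) * (z₀ + ∑ i, z i * ((1 + s * t)⁻¹ • (ξ₀ + s • ξ)) i) =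
              z₀ + ∑ i, z i * ξ₀ i + s * (z₀ * t + ∑ i, z i * ξ i) := by
            have h4 : ∀ i, z i * ((1 + s * t)⁻¹ • (ξ₀ + s • ξ)) i =
                (1 + s * t)⁻¹ * (z i * ξ₀ i + s * (z i * ξ i)) := fun i => by
              simp only [Pi.smul_apply, Pi.add_apply, smul_eq_mul]; ring
            simp only [h4, ← Finset.mul_sum, Finset.sum_add_distrib]
            field_simp
            ring
          rwa [h3] at h2
        · have h2 := (h₀.add (hM.smul hs)).smul (inv_nonneg.2 hst.le)
          convert h2 using 1
          have h5 : A = (1 + s * t)⁻¹ • (A + s • t • A) := by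
            rw [smul_smul s t, ← one_smul ℝ A, smul_smul, ← add_smul, smul_smul, mul_one,
              inv_mul_cancel₀ hst.ne']
          conv_lhs => rw [h5]
          simp only [Pi.smul_apply, Pi.add_apply, smul_assoc, add_smul, Finset.sum_add_distrib,
            ← Finset.smul_sum, smul_add]
          abel
      have hx' : ∑ o, x o * homogenize z₀ z 0 o = z₀ * t + ∑ i, z i * ξ i := by
        simp [Fintype.sum_option, homogenize, mul_comm, t, ξ]
      rw [hx']
      by_contra! hneg
      have := hb ((|z₀ + ∑ i, z i * ξ₀ i| + 1) / -(z₀ * t + ∑ i, z i * ξ i))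
        (div_nonneg (by positivity) (by linarith))
      rw [div_mul_eq_mul_div, div_neg, mul_div_cancel_right₀ _ hneg.ne] at this
      linarith [le_abs_self (z₀ + ∑ i, z i * ξ₀ i)]

lemma iterCoeff_C_mul (i j : ℕ) (a : ℝ) (f : PowerSeries (PowerSeries ℝ)) :
    iterCoeff i j (PowerSeries.C (PowerSeries.C a) * f) = a * iterCoeff i j f := by
  simp [iterCoeff]

open Matrix in
/-- A positive semidefinite certificate at a point of a linear matrix inequality expands along a
ring homomorphism fixing the coefficients into a sum of squares. -/
lemma sum_map_trace_mul_eq_sum_sq {R ι n : Type*} [CommRing R] [Fintype ι] [Fintype n]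
    {G : ι → Matrix n n ℝ} {x : ι → ℝ} {H V : Matrix n n ℝ} (hH : ∑ o, x o • G o = Hᵀ * H)
    {σ τ : ℝ →+* R} (hτ : ∀ o a b, τ (G o a b) = σ (G o a b)) :
    ∑ o, σ ((Vᵀ * V * G o).trace) * τ (x o) =
      ∑ l : n × n, (∑ c, σ (V l.1 c) * τ (H l.2 c)) ^ 2 := by
  have hGτ : ∀ o, (G o).map σ = (G o).map τ := fun o => Matrix.ext fun a b => (hτ o a b).symm
  have hHτ : ∑ o, τ (x o) • (G o).map τ = (H.map τ)ᵀ * H.map τ := by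
    rw [← transpose_map, ← Matrix.map_mul, ← hH]
    ext a b
    simp [Matrix.sum_apply]
  calc ∑ o, σ ((Vᵀ * V * G o).trace) * τ (x o)
      = ((V.map σ)ᵀ * V.map σ * ∑ o, τ (x o) • (G o).map τ).trace := by
        rw [Matrix.mul_sum, trace_sum]
        refine Finset.sum_congr rfl fun o _ => ?_
        rw [mul_smul_comm, trace_smul, smul_eq_mul, mul_comm, ← hGτ, ← transpose_map,
          ← Matrix.map_mul, ← Matrix.map_mul, AddMonoidHom.map_trace σ]
    _ = ((V.map σ * (H.map τ)ᵀ) * (V.map σ * (H.map τ)ᵀ)ᵀ).trace := by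
        rw [hHτ, transpose_mul, transpose_transpose, Matrix.mul_assoc, trace_mul_comm]
        simp only [Matrix.mul_assoc]
    _ = _ := by
        simp only [trace, diag_apply, mul_apply, transpose_apply, map_apply, pow_two,
          Fintype.sum_prod_type]

open Filter Topology in
/-- Limits of functionals with positive semidefinite certificates expand, along a ring homomorphism
fixing the coefficients of the linear matrix inequality, into power series that can be approximated
by sums of squares from a fixed finite-dimensional space. -/
lemma exists_finiteDimensional_sum_sq_approximation {ι n : Type*} [Fintype ι] [Fintype n]
    {G : ι → Matrix n n ℝ} {x : ι → ℝ} (hx : (∑ o, x o • G o).PosSemidef)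
    {τ : ℝ →+* PowerSeries (PowerSeries ℝ)}
    (hτ : ∀ o a b, τ (G o a b) = PowerSeries.C (PowerSeries.C (G o a b))) :
    ∃ U : Submodule ℝ (PowerSeries (PowerSeries ℝ)), FiniteDimensional ℝ U ∧
      ∀ z ∈ closure {w : ι → ℝ | ∃ Q : Matrix n n ℝ, Q.PosSemidef ∧ w = fun o => (Q * G o).trace},
        ∀ (M : ℕ) (ε : ℝ), 0 < ε → ∃ u : n × n → PowerSeries (PowerSeries ℝ), (∀ l, u l ∈ U) ∧
          ∀ i j, i + j < M → |iterCoeff i j (∑ l, u l ^ 2) -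
            iterCoeff i j (∑ o, PowerSeries.C (PowerSeries.C (z o)) * τ (x o))| < ε := by
  obtain ⟨H, hH⟩ := hx.exists_eq_transpose_mul_self
  refine ⟨Submodule.span ℝ (Set.range fun l : n × n => τ (H l.1 l.2)),
    FiniteDimensional.span_of_finite ℝ (Set.finite_range _), fun z hz M ε hε => ?_⟩
  have hcont : ∀ i j, Continuous fun w : ι → ℝ =>
      iterCoeff i j (∑ o, PowerSeries.C (PowerSeries.C (w o)) * τ (x o)) := by
    intro i j
    simp only [map_sum, iterCoeff_C_mul]
    fun_prop
  have hev : ∀ᶠ w in 𝓝 z, ∀ i ∈ Finset.range M, ∀ j ∈ Finset.range M,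
      |iterCoeff i j (∑ o, PowerSeries.C (PowerSeries.C (w o)) * τ (x o)) -
        iterCoeff i j (∑ o, PowerSeries.C (PowerSeries.C (z o)) * τ (x o))| < ε := by
    rw [eventually_all_finset]
    intro i _
    rw [eventually_all_finset]
    intro j _
    exact Metric.tendsto_nhds.1 (hcont i j).continuousAt ε hε
  obtain ⟨_, ⟨Q, hQ, rfl⟩, hw⟩ := ((mem_closure_iff_frequently.1 hz).and_eventually hev).exists
  obtain ⟨V, rfl⟩ := hQ.exists_eq_transpose_mul_self
  refine ⟨fun l => ∑ c, PowerSeries.C (PowerSeries.C (V l.1 c)) * τ (H l.2 c), fun l => ?_,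
    fun i j hij => ?_⟩
  · refine Submodule.sum_mem _ fun c _ => ?_
    have := Submodule.smul_mem (Submodule.span ℝ (Set.range fun l : n × n => τ (H l.1 l.2)))
      (V l.1 c) (Submodule.subset_span ⟨(l.2, c), rfl⟩)
    convert this using 1
    ext i j
    simp
  · have := hw i (Finset.mem_range.2 (by omega)) j (Finset.mem_range.2 (by omega))
    have h2 := sum_map_trace_mul_eq_sum_sq (V := V) hH (τ := τ)
      (σ := (PowerSeries.C (R := PowerSeries ℝ)).comp (PowerSeries.C (R := ℝ))) hτ
    simp only [RingHom.comp_apply] at h2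
    rwa [h2] at this

/-- The constant term of the scaled and translated Motzkin polynomial
`c ^ 4 * (y - b) ^ 2 + c ^ 2 * (y - b) ^ 4 + (x - a) ^ 6 - 3 * c ^ 2 * (x - a) ^ 2 * (y - b) ^ 2`. -/
def scaledMotzkinConst (c a b : ℝ) : ℝ :=
  c ^ 4 * b ^ 2 + c ^ 2 * b ^ 4 + a ^ 6 - 3 * c ^ 2 * a ^ 2 * b ^ 2

/-- The coefficients of the scaled and translated Motzkin polynomial
`c ^ 4 * (y - b) ^ 2 + c ^ 2 * (y - b) ^ 4 + (x - a) ^ 6 - 3 * c ^ 2 * (x - a) ^ 2 * (y - b) ^ 2`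
at its nonconstant monomials. -/
def scaledMotzkinVec (c a b : ℝ) : Fin 14 → ℝ :=
  ![-6 * a ^ 5 + 6 * c ^ 2 * a * b ^ 2, 15 * a ^ 4 - 3 * c ^ 2 * b ^ 2, -20 * a ^ 3, 15 * a ^ 2,
    -6 * a, 1, -2 * c ^ 4 * b - 4 * c ^ 2 * b ^ 3 + 6 * c ^ 2 * a ^ 2 * b,
    c ^ 4 + 6 * c ^ 2 * b ^ 2 - 3 * c ^ 2 * a ^ 2, -4 * c ^ 2 * b, c ^ 2,
    -12 * c ^ 2 * a * b, 6 * c ^ 2 * b, 6 * c ^ 2 * a, -3 * c ^ 2]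

lemma scaledMotzkin_eq {R : Type*} [CommRing R] (σ : ℝ →+* R) (c a b : ℝ) (x y : R) :
    σ (scaledMotzkinConst c a b) + ∑ i, σ (scaledMotzkinVec c a b i) *
      ![x, x ^ 2, x ^ 3, x ^ 4, x ^ 5, x ^ 6, y, y ^ 2, y ^ 3, y ^ 4,
        x * y, x ^ 2 * y, x * y ^ 2, x ^ 2 * y ^ 2] i =
    σ c ^ 4 * (y - σ b) ^ 2 + σ c ^ 2 * (y - σ b) ^ 4 + (x - σ a) ^ 6 -
      3 * (σ c ^ 2 * ((x - σ a) ^ 2 * (y - σ b) ^ 2)) := by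
  simp [Fin.sum_univ_succ, scaledMotzkinConst, scaledMotzkinVec]
  simp only [map_ofNat]
  ring

lemma scaledMotzkin_nonneg {c : ℝ} (hc : 0 ≤ c) (x y : ℝ) :
    0 ≤ c ^ 4 * y ^ 2 + c ^ 2 * y ^ 4 + x ^ 6 - 3 * (c ^ 2 * (x ^ 2 * y ^ 2)) := by
  have h : 0 ≤ (x ^ 2 - c * |y|) ^ 2 * (x ^ 2 + 2 * (c * |y|)) + (c ^ 2 * |y| - c * |y| ^ 2) ^ 2 :=
    by positivity
  have hy : y ^ 4 = |y| ^ 4 := by rw [show 4 = 2 * 2 from rfl, pow_mul, pow_mul, sq_abs]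
  rw [← sq_abs y, hy]
  linarith

lemma iterCoeff_X_pow_mul_C_X_pow (i j k l : ℕ) :
    iterCoeff i j (PowerSeries.X ^ k * PowerSeries.C PowerSeries.X ^ l) =
      if i = k ∧ j = l then 1 else 0 := by
  have h : iterCoeff i j (PowerSeries.X ^ k * PowerSeries.C PowerSeries.X ^ l) =
      PowerSeries.coeff j (PowerSeries.coeff i (PowerSeries.X ^ k) * PowerSeries.X ^ l) := by
    simp only [iterCoeff, ← map_pow, LinearMap.coe_mk, AddHom.coe_mk, PowerSeries.coeff_mul_C]
  rw [h, PowerSeries.coeff_X_pow]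
  by_cases hi : i = k <;> simp [hi, PowerSeries.coeff_X_pow]

lemma pow_mul_iterCoeff_scaledMotzkin (c : ℝ) (i j : ℕ) :
    c ^ (i + j) * iterCoeff i j (PowerSeries.C (PowerSeries.C c) ^ 4 * PowerSeries.C PowerSeries.X ^ 2
      + PowerSeries.C (PowerSeries.C c) ^ 2 * PowerSeries.C PowerSeries.X ^ 4 + PowerSeries.X ^ 6
      - 3 * (PowerSeries.C (PowerSeries.C c) ^ 2 *
        (PowerSeries.X ^ 2 * PowerSeries.C PowerSeries.X ^ 2))) = c ^ 6 * motzkinCoeff i j := by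
  have h1 := fun l => iterCoeff_X_pow_mul_C_X_pow i j 0 l
  have h2 := fun k => iterCoeff_X_pow_mul_C_X_pow i j k 0
  simp only [pow_zero, one_mul, mul_one] at h1 h2
  have h3 : (3 : PowerSeries (PowerSeries ℝ)) = PowerSeries.C (PowerSeries.C 3) := by
    rw [map_ofNat, map_ofNat]
  have h4 : ∀ k : ℕ, (PowerSeries.C (PowerSeries.C c) : PowerSeries (PowerSeries ℝ)) ^ k =
      PowerSeries.C (PowerSeries.C (c ^ k)) := fun k => by simp
  rw [h3, h4, h4, map_sub, map_add, map_add]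
  simp only [iterCoeff_C_mul, iterCoeff_X_pow_mul_C_X_pow, h1, h2, motzkinCoeff]
  split_ifs with h5 h6 h7 h8 h7 h8 h7 h8 h6 h7 h8 h7 h8 h7 h8 <;>
    first | omega | (obtain ⟨rfl, rfl⟩ := ‹_ ∧ _›; ring) | ring

lemma affine_nonneg_of_mem_closure_convexHull {k : ℕ} {s : Set (Fin k → ℝ)} {z₀ : ℝ}
    {z : Fin k → ℝ} (h : ∀ ξ ∈ s, 0 ≤ z₀ + ∑ i, z i * ξ i) :
    ∀ ξ ∈ closure (convexHull ℝ s), 0 ≤ z₀ + ∑ i, z i * ξ i := by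
  have hconv : Convex ℝ {ξ : Fin k → ℝ | 0 ≤ z₀ + ∑ i, z i * ξ i} := by
    intro x hx y hy a b ha hb hab
    rw [Set.mem_ofPred_eq] at hx hy ⊢
    have hxy : z₀ + ∑ i, z i * (a • x + b • y) i =
        a * (z₀ + ∑ i, z i * x i) + b * (z₀ + ∑ i, z i * y i) := by
      simp only [Pi.add_apply, Pi.smul_apply, smul_eq_mul, mul_add, Finset.sum_add_distrib,
        Finset.mul_sum, mul_left_comm]
      linear_combination -z₀ * hab
    rw [hxy]
    positivity
  have hclosed : IsClosed {ξ : Fin k → ℝ | 0 ≤ z₀ + ∑ i, z i * ξ i} :=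
    isClosed_le continuous_const (by fun_prop)
  exact fun ξ hξ => closure_minimal (convexHull_min h hconv) hclosed hξ

/-- evaluation of the 14 monomials
`x, x², x³, x⁴, x⁵, x⁶, y, y², y³, y⁴, xy, x²y, xy², x²y²`. -/
theorem closure_convexHull_motzkinVeronese_not_spectrahedralShadow
    (φ : (Fin 2 → ℝ) → (Fin 14 → ℝ))
    (hφ : φ = fun ξ => ![ξ 0, ξ 0 ^ 2, ξ 0 ^ 3, ξ 0 ^ 4, ξ 0 ^ 5, ξ 0 ^ 6,
      ξ 1, ξ 1 ^ 2, ξ 1 ^ 3, ξ 1 ^ 4,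
      ξ 0 * ξ 1, ξ 0 ^ 2 * ξ 1, ξ 0 * ξ 1 ^ 2, ξ 0 ^ 2 * ξ 1 ^ 2])
    (S : Set (Fin 2 → ℝ)) (hS : IsSemialgebraic S) (hint : (interior S).Nonempty) :
    ¬ IsSpectrahedralShadow (closure (convexHull ℝ (φ '' S))) := by
  intro hK
  obtain ⟨p₀, hp₀⟩ := hint
  have hφK : ∀ p ∈ S, φ p ∈ closure (convexHull ℝ (φ '' S)) := fun p hp =>
    subset_closure (subset_convexHull ℝ _ (Set.mem_image_of_mem φ hp))
  obtain ⟨n, m, G, hG, hdual⟩ := hK.exists_pencil ⟨_, hφK p₀ (interior_subset hp₀)⟩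
  obtain ⟨p, hp, τ, hτ, hτ0, hτ1⟩ := exists_generic_taylor
    (s := Set.range fun t : Option (Fin 14 ⊕ Fin m) × (Fin n ⊕ Unit) × (Fin n ⊕ Unit) =>
      G t.1 t.2.1 t.2.2) (Set.countable_range _) ⟨p₀, hp₀⟩
  obtain ⟨η, hη⟩ := hG _ (hφK p hp)
  obtain ⟨U, hU, happrox⟩ := exists_finiteDimensional_sum_sq_approximation hη
    fun o a b => hτ _ ⟨(o, a, b), rfl⟩
  refine not_sum_sq_approximates_scaled_motzkin
    (Λ := (Fin n ⊕ Unit) × (Fin n ⊕ Unit)) U fun M c ε hc hc1 hε => ?_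
  have hnonneg : ∀ ξ ∈ closure (convexHull ℝ (φ '' S)),
      0 ≤ scaledMotzkinConst c (p 0) (p 1) + ∑ i, scaledMotzkinVec c (p 0) (p 1) i * ξ i := by
    refine affine_nonneg_of_mem_closure_convexHull ?_
    rintro _ ⟨q, -, rfl⟩
    have h := scaledMotzkin_eq (RingHom.id ℝ) c (p 0) (p 1) (q 0) (q 1)
    simp only [RingHom.id_apply] at h
    rw [hφ, h]
    exact scaledMotzkin_nonneg hc.le _ _
  obtain ⟨u, huU, hu⟩ := happrox _ (hdual _ _ hnonneg) M ε hε
  refine ⟨u, huU, fun i j hij => ?_⟩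
  have hF := scaledMotzkin_eq ((PowerSeries.C (R := PowerSeries ℝ)).comp (PowerSeries.C (R := ℝ)))
    c (p 0) (p 1) (τ (p 0)) (τ (p 1))
  have hτφ : ∀ i, τ (φ p i) = ![τ (p 0), τ (p 0) ^ 2, τ (p 0) ^ 3, τ (p 0) ^ 4, τ (p 0) ^ 5,
      τ (p 0) ^ 6, τ (p 1), τ (p 1) ^ 2, τ (p 1) ^ 3, τ (p 1) ^ 4, τ (p 0) * τ (p 1),
      τ (p 0) ^ 2 * τ (p 1), τ (p 0) * τ (p 1) ^ 2, τ (p 0) ^ 2 * τ (p 1) ^ 2] i := by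
    intro i
    fin_cases i <;> simp [hφ]
  simp only [← hτφ, RingHom.comp_apply] at hF
  simp only [hτ0, hτ1, add_sub_cancel_left] at hF
  have hsum : ∑ o, PowerSeries.C (PowerSeries.C (homogenize (scaledMotzkinConst c (p 0) (p 1))
      (scaledMotzkinVec c (p 0) (p 1)) 0 o)) * τ (homogenize 1 (φ p) η o) =
      PowerSeries.C (PowerSeries.C (scaledMotzkinConst c (p 0) (p 1))) + ∑ i,
        PowerSeries.C (PowerSeries.C (scaledMotzkinVec c (p 0) (p 1) i)) * τ (φ p i) := by
    simp [Fintype.sum_option, homogenize]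
  rw [← pow_mul_iterCoeff_scaledMotzkin, ← mul_sub, abs_mul, abs_of_pos (pow_pos hc _), ← hF, ← hsum]
  exact (mul_le_of_le_one_left (abs_nonneg _) (pow_le_one₀ hc.le hc1)).trans_lt (hu i j hij)
end

section
/- Let S ⊆ ℝ^n be a set with convex hull K. Let A be a commutative ℝ-algebra and a_1, …, a_n ∈ A, and assume that for every affine-linear polynomial f = c_0 + c_1x_1 + … + c_nx_n with real coefficients satisfying f(ξ) ≥ 0 for all ξ ∈ S, the element c_0·1 + c_1a_1 + … + c_na_n of A is a finite sum of squares in A. Then for every ℝ-algebra homomorphism ρ : A → ℝ, the point (ρ(a_1), …, ρ(a_n)) lies in the closure of K in ℝ^n. -/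
theorem IsSumSq.map_ringHom {R T : Type*} [NonAssocSemiring R] [NonAssocSemiring T]
    (f : R →+* T) {s : R} (hs : IsSumSq s) : IsSumSq (f s) := by
  induction hs with
  | zero => simp
  | sq_add a _ ih => simpa using IsSumSq.sq_add (f a) ih

/-- if every affine-linear polynomial nonnegative on `S` pulls back to a sum
of squares in `A` (via `xᵢ ↦ aᵢ`), then every `ℝ`-algebra homomorphism `ρ : A → ℝ` sends
`(a₁, …, a_n)` into the closure of the convex hull of `S`. -/
theorem algHom_point_mem_closure_convexHull
    (n : ℕ) (S : Set (Fin n → ℝ)) (K : Set (Fin n → ℝ)) (hK : K = convexHull ℝ S)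
    (A : Type) [CommRing A] [Algebra ℝ A] (a : Fin n → A)
    (hsos : ∀ (c₀ : ℝ) (c : Fin n → ℝ), (∀ ξ ∈ S, 0 ≤ c₀ + ∑ i, c i * ξ i) →
      IsSumSq (algebraMap ℝ A c₀ + ∑ i, c i • a i)) :
    ∀ ρ : A →ₐ[ℝ] ℝ, (fun i => ρ (a i)) ∈ closure K := by
  intro ρ
  subst hK
  by_contra hρ
  obtain ⟨f, u, hfρ, hfS⟩ :=
    geometric_hahn_banach_point_closed (convex_convexHull ℝ S).closure isClosed_closure hρ
  have hf (x : Fin n → ℝ) : f x = ∑ i, f (Pi.single i 1) * x i := by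
    conv_lhs => rw [pi_eq_sum_univ' x, map_sum]
    simp [mul_comm]
  have hsq := hsos (-u) (fun i => f (Pi.single i 1)) fun ξ hξ => by
    have := hfS ξ (subset_closure (subset_convexHull ℝ S hξ))
    rw [hf] at this
    linarith
  have hnonneg := (hsq.map_ringHom (ρ : A →+* ℝ)).nonneg
  rw [hf] at hfρ
  simp only [RingHom.coe_coe, map_add, map_sum, map_smul, AlgHom.commutes, smul_eq_mul,
    Algebra.algebraMap_self, RingHom.id_apply] at hnonneg
  linarith
end
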